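/- For every n ≥ 1, the unordered configuration space of n distinct points in the plane — the quotient of Conf_n(ℂ) by the permutation action of the symmetric group Σ_n on coordinates — is path-connected and aspherical: its homotopy groups π_k are trivial for every k ≥ 2. (This is the homotopy-theoretic content of the classical fact that this quotient is a classifying space for the braid group B_n.) -/

import Mathlib

/-- The ordered configuration space of `n` points in the plane `ℂ`:
injective tuples, topologized as a subspace of `ℂ^n`. -/
abbrev Conf (n : ℕ) := {f : Fin n → ℂ // Function.Injective f}

/-- Two ordered configurations are related iff they differ by a permutation
of the coordinates. -/
def permRel (n : ℕ) : Conf n → Conf n → Prop := fun f g =>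
  ∃ σ : Equiv.Perm (Fin n), (g : Fin n → ℂ) = (f : Fin n → ℂ) ∘ σ

/-- The unordered configuration space of `n` points in the plane:
the quotient of `Conf_n(ℂ)` by the coordinate-permutation action of `Σ_n`. -/
abbrev UConf (n : ℕ) := Quot (permRel n)

section
open Set Metric Topology Filter


/-- Null-homotopy relative to `B` inside the set `V`. -/
def NullIn {E X : Type*} [TopologicalSpace E] [TopologicalSpace X] (B : Set E) (V : Set X)
    (f : E → X) (c : X) : Prop :=
  ∃ H : unitInterval × E → X, Continuous H ∧ (∀ p, H p ∈ V) ∧ (∀ x, H (0, x) = f x) ∧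
    (∀ x, H (1, x) = c) ∧ ∀ t, ∀ x ∈ B, H (t, x) = c

lemma NullIn.map {E X Y : Type*} [TopologicalSpace E] [TopologicalSpace X] [TopologicalSpace Y]
    {B : Set E} {V : Set X} {W : Set Y} {f : E → X} {c : X} {q : X → Y} (h : NullIn B V f c)
    (hq : ContinuousOn q V) (hm : MapsTo q V W) : NullIn B W (fun x => q (f x)) (q c) := by
  obtain ⟨H, h1, h2, h3, h4, h5⟩ := h
  refine ⟨fun p => q (H p), hq.comp_continuous h1 h2, fun p => hm (h2 p), ?_, ?_, ?_⟩
  · intro x; simp [h3]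
  · intro x; simp [h4]
  · intro t x hx; simp [h5 t x hx]

/-- Disc automorphism. -/
noncomputable def mob (a z : ℂ) : ℂ := (z - a) / (1 - (starRingEnd ℂ) a * z)

lemma mob_den {a z : ℂ} (ha : ‖a‖ < 1) (hz : ‖z‖ < 1) : 1 - (starRingEnd ℂ) a * z ≠ 0 := by
  intro h
  have h1 : (starRingEnd ℂ) a * z = 1 := (sub_eq_zero.mp h).symm
  have h2 : ‖a‖ * ‖z‖ = 1 := by
    have := congrArg norm h1
    simpa using this
  nlinarith [norm_nonneg a, norm_nonneg z]

lemma mob_den_sq (a z : ℂ) :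
    ‖1 - (starRingEnd ℂ) a * z‖ ^ 2 - ‖z - a‖ ^ 2 = (1 - ‖a‖ ^ 2) * (1 - ‖z‖ ^ 2) := by
  simp only [← Complex.normSq_eq_norm_sq, Complex.normSq_apply]
  simp
  ring

lemma one_sub_mob {a z : ℂ} (ha : ‖a‖ < 1) (hz : ‖z‖ < 1) :
    1 - ‖mob a z‖ ^ 2 = (1 - ‖a‖ ^ 2) * (1 - ‖z‖ ^ 2) / ‖1 - (starRingEnd ℂ) a * z‖ ^ 2 := by
  have := mob_den ha hz
  have h : ‖1 - (starRingEnd ℂ) a * z‖ ≠ 0 := norm_ne_zero_iff.mpr this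
  rw [← mob_den_sq, mob, norm_div, div_pow, sub_div, div_self (pow_ne_zero 2 h)]

lemma mob_lt {a z : ℂ} (ha : ‖a‖ < 1) (hz : ‖z‖ < 1) : ‖mob a z‖ < 1 := by
  have h := one_sub_mob ha hz
  have h2 : 0 < ‖1 - (starRingEnd ℂ) a * z‖ := norm_pos_iff.mpr (mob_den ha hz)
  have h3 : 0 < 1 - ‖mob a z‖ ^ 2 := by
    rw [h]
    have : 0 < 1 - ‖a‖ ^ 2 := by nlinarith [norm_nonneg a]
    have : 0 < 1 - ‖z‖ ^ 2 := by nlinarith [norm_nonneg z]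
    positivity
  nlinarith [norm_nonneg (mob a z)]

lemma mob_inv {a z : ℂ} (ha : ‖a‖ < 1) (hz : ‖z‖ < 1) : mob (-a) (mob a z) = z := by
  have h := mob_den ha hz
  have h' := mob_den ha ha
  have h2 : ‖-a‖ < 1 := by simpa using ha
  have h1 := mob_den h2 (mob_lt ha hz)
  unfold mob at *
  rw [div_eq_iff h1]
  simp only [map_neg]
  have e : (z - a) / (1 - (starRingEnd ℂ) a * z) * (1 - (starRingEnd ℂ) a * z) = z - a :=
    div_mul_cancel₀ _ h
  generalize (z - a) / (1 - (starRingEnd ℂ) a * z) = w at *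
  linear_combination e

lemma mob_self (a : ℂ) : mob a a = 0 := by simp [mob]
lemma mob_zero (a : ℂ) : mob a 0 = -a := by simp [mob]

lemma mob_hasDeriv {a z : ℂ} (h : 1 - (starRingEnd ℂ) a * z ≠ 0) :
    HasDerivAt (mob a) ((1 - (starRingEnd ℂ) a * a) / (1 - (starRingEnd ℂ) a * z) ^ 2) z := by
  have h1 : HasDerivAt (fun z : ℂ => z - a) 1 z := (hasDerivAt_id z).sub_const a
  have h2 : HasDerivAt (fun z : ℂ => 1 - (starRingEnd ℂ) a * z) (-(starRingEnd ℂ) a) z := by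
    simpa using ((hasDerivAt_id z).const_mul ((starRingEnd ℂ) a)).const_sub 1
  have := h1.div h2 h
  refine this.congr_deriv ?_
  congr 1; ring

lemma mob_diff {a : ℂ} (ha : ‖a‖ < 1) : DifferentiableOn ℂ (mob a) (ball 0 1) := by
  intro z hz
  exact (mob_hasDeriv (mob_den ha (by simpa using hz))).differentiableAt.differentiableWithinAt

lemma mob_deriv_zero (a : ℂ) : HasDerivAt (mob a) (1 - (‖a‖ : ℂ) ^ 2) 0 := by
  have := mob_hasDeriv (a := a) (z := 0) (by simp)
  refine this.congr_deriv ?_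
  simp [← Complex.normSq_eq_conj_mul_self, Complex.normSq_eq_norm_sq]

lemma mob_deriv_self {a : ℂ} (ha : ‖a‖ < 1) :
    HasDerivAt (mob a) (1 / (1 - (‖a‖ : ℂ) ^ 2)) a := by
  have h0 := mob_den ha ha
  have := mob_hasDeriv (a := a) (z := a) h0
  refine this.congr_deriv ?_
  have e : (starRingEnd ℂ) a * a = (‖a‖ : ℂ) ^ 2 := by
    simp [← Complex.normSq_eq_conj_mul_self, Complex.normSq_eq_norm_sq]
  rw [e] at h0 ⊢
  field_simp

/-- Holomorphic square roots on discs. -/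
lemma holo_sqrt {c : ℂ} {ρ : ℝ} (hρ : 0 < ρ) {h : ℂ → ℂ} (hd : DifferentiableOn ℂ h (ball c ρ))
    (hn : ∀ z ∈ ball c ρ, h z ≠ 0) :
    ∃ G : ℂ → ℂ, DifferentiableOn ℂ G (ball c ρ) ∧ ∀ z ∈ ball c ρ, G z ^ 2 = h z := by
  have hd' : DifferentiableOn ℂ (fun z => deriv h z / h z) (ball c ρ) :=
    (hd.deriv isOpen_ball).div hd hn
  obtain ⟨g, hg⟩ := hd'.isExactOn_ball
  have hc : c ∈ ball c ρ := mem_ball_self hρ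
  have hk : ∀ z ∈ ball c ρ, HasDerivAt (fun z => h z * Complex.exp (-g z)) 0 z := by
    intro z hz
    have h1 : HasDerivAt h (deriv h z) z :=
      ((hd z hz).differentiableAt (isOpen_ball.mem_nhds hz)).hasDerivAt
    refine (h1.mul ((hg z hz).neg.cexp)).congr_deriv ?_
    have := hn z hz
    field_simp
    ring
  have hconst : ∀ z ∈ ball c ρ, h z * Complex.exp (-g z) = h c * Complex.exp (-g c) := by
    intro z hz
    refine isOpen_ball.is_const_of_deriv_eq_zero (convex_ball c ρ).isPreconnected
      (f := fun z => h z * Complex.exp (-g z))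
      (fun z hz => (hk z hz).differentiableAt.differentiableWithinAt)
      (fun z hz => (hk z hz).deriv) hz hc
  obtain ⟨k, hk⟩ := IsSquare.exists_sq (h c * Complex.exp (-g c)) (by
    obtain ⟨k, hk⟩ := IsAlgClosed.exists_pow_nat_eq (h c * Complex.exp (-g c)) (n := 2) (by norm_num)
    exact ⟨k, by rw [← hk, sq]⟩)
  refine ⟨fun z => k * Complex.exp (g z / 2), ?_, ?_⟩
  · intro z hz
    exact (((hg z hz).div_const 2).cexp.const_mul k).differentiableAt.differentiableWithinAt
  · intro z hz
    have := hconst z hz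
    rw [mul_pow, ← hk, ← this, ← Complex.exp_nat_mul]
    rw [mul_assoc, ← Complex.exp_add]
    have : -g z + ((2 : ℕ) : ℂ) * (g z / 2) = 0 := by push_cast; ring
    rw [this]; simp

/-- Continuous square roots on real normed spaces. -/
lemma cont_sqrt {E : Type*} [NormedAddCommGroup E] [NormedSpace ℝ E] {g : E → ℂ}
    (hg : Continuous g) (hn : ∀ x, g x ≠ 0) : ∃ s : E → ℂ, Continuous s ∧ ∀ x, s x ^ 2 = g x := by
  obtain ⟨F, ⟨-, hF⟩, -⟩ := Complex.isCoveringMapOn_exp.existsUnique_continuousMap_lifts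
    ⟨g, hg⟩ (a₀ := 0) (e₀ := Complex.log (g 0)) (Complex.exp_log (hn 0)) (fun a => hn a)
  refine ⟨fun x => Complex.exp (F x / 2), by fun_prop, fun x => ?_⟩
  rw [← Complex.exp_nat_mul]
  have := congrFun hF x
  simp only [Function.comp, ContinuousMap.coe_mk] at this
  rw [← this]; congr 1; push_cast; ring

/-- Schwarz-Pick type bound. -/
lemma schwarz_pick {L : ℂ → ℂ} {c z : ℂ} {ρ : ℝ} (hd : DifferentiableOn ℂ L (ball c ρ))
    (hm : ∀ w ∈ ball c ρ, ‖L w‖ < 1) (hρ : 0 < ρ) (hz : dist z c < ρ / 2) :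
    3 / 16 * (1 - ‖L c‖ ^ 2) ≤ 1 - ‖L z‖ ^ 2 := by
  have hc : c ∈ ball c ρ := mem_ball_self hρ
  have hzb : z ∈ ball c ρ := by rw [mem_ball]; linarith
  set a := L c with ha
  have ha1 : ‖a‖ < 1 := hm c hc
  have hz1 := hm z hzb
  have h1 : ‖mob a (L z)‖ ≤ 1 / 2 := by
    have := Complex.dist_le_div_mul_dist_of_mapsTo_ball (f := fun w => mob a (L w)) (c := c) (z := z)
      (R₁ := ρ) (R₂ := 1) ((mob_diff ha1).comp hd (fun w hw => by simpa using hm w hw)) (by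
        intro w hw
        simp only [← ha, mob_self, mem_closedBall, dist_zero_right]
        exact (mob_lt ha1 (hm w hw)).le) hzb
    simp only [← ha, mob_self, dist_zero_right] at this
    refine this.trans ?_
    rw [div_mul_eq_mul_div, div_le_iff₀ hρ]; linarith
  have ha2 : ‖-a‖ < 1 := by simpa using ha1
  have h2 := one_sub_mob ha2 (z := mob a (L z)) (by linarith)
  rw [mob_inv ha1 hz1] at h2
  rw [h2]
  have hden : 0 < ‖1 - (starRingEnd ℂ) (-a) * mob a (L z)‖ :=
    norm_pos_iff.mpr (mob_den ha2 (by linarith))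
  have hden2 : ‖1 - (starRingEnd ℂ) (-a) * mob a (L z)‖ ≤ 2 := by
    refine (norm_sub_le _ _).trans ?_
    simp only [norm_mul, norm_one, RCLike.norm_conj]
    nlinarith [norm_nonneg (-a), norm_nonneg (mob a (L z))]
  rw [le_div_iff₀ (by positivity)]
  have e1 : 0 ≤ 1 - ‖a‖ ^ 2 := by nlinarith [norm_nonneg a]
  have e2 : 3 / 4 ≤ 1 - ‖mob a (L z)‖ ^ 2 := by nlinarith [norm_nonneg (mob a (L z))]
  have e3 : ‖1 - (starRingEnd ℂ) (-a) * mob a (L z)‖ ^ 2 ≤ 4 := by nlinarith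
  rw [norm_neg]
  nlinarith [mul_le_mul_of_nonneg_left e3 e1, mul_le_mul_of_nonneg_left e2 e1]


structure KState {E : Type*} [NormedAddCommGroup E] [NormedSpace ℝ E] (B : Set E) (f : E → ℂ)
    (U : Set ℂ) (ρ δ s : ℝ) (V : Set ℂ) (F : E → ℂ) : Prop where
  sub : ∀ v ∈ V, ‖v‖ < 1
  cont : Continuous F
  mem : ∀ x, F x ∈ V
  bd : ∀ x ∈ B, F x = 0
  null : NullIn B V F 0 → NullIn B U f 0
  loc : ∀ x, ∃ L : ℂ → ℂ, DifferentiableOn ℂ L (ball (f x) ρ) ∧ MapsTo L (ball (f x) ρ) V ∧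
    ∀ y ∈ ball x δ, F y = L (f y)
  der : ∃ L : ℂ → ℂ, DifferentiableOn ℂ L (ball 0 ρ) ∧ MapsTo L (ball 0 ρ) V ∧ L 0 = 0 ∧
    s ≤ ‖deriv L 0‖

/-- signed holomorphic root of `mob p ∘ L`. -/
lemma holo_root {L : ℂ → ℂ} {c p u : ℂ} {ρ : ℝ} {V : Set ℂ} (hρ : 0 < ρ)
    (hV : ∀ v ∈ V, ‖v‖ < 1) (hp : ‖p‖ < 1) (hpV : p ∉ V)
    (hd : DifferentiableOn ℂ L (ball c ρ)) (hm : MapsTo L (ball c ρ) V)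
    (hu : u ^ 2 = mob p (L c)) :
    ∃ G : ℂ → ℂ, DifferentiableOn ℂ G (ball c ρ) ∧ (∀ z ∈ ball c ρ, G z ^ 2 = mob p (L z)) ∧
      G c = u := by
  have hc : c ∈ ball c ρ := mem_ball_self hρ
  obtain ⟨G, h1, h2⟩ := holo_sqrt (h := fun z => mob p (L z)) hρ
    ((mob_diff hp).comp hd (fun w hw => by simpa using hV _ (hm hw))) (by
      intro z hz h
      have h3 := mob_inv hp (hV _ (hm hz))
      rw [h, mob_zero, neg_neg] at h3
      exact hpV (h3 ▸ hm hz))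
  have : G c ^ 2 = u ^ 2 := by rw [h2 c hc, hu]
  rcases sq_eq_sq_iff_eq_or_eq_neg.mp this with h | h
  · exact ⟨G, h1, h2, h⟩
  · refine ⟨fun z => - G z, h1.neg, fun z hz => by simpa using h2 z hz, by simp [h]⟩

lemma KState.step {E : Type*} [NormedAddCommGroup E] [NormedSpace ℝ E] {B : Set E} {f : E → ℂ}
    {U : Set ℂ} {ρ δ s : ℝ} {V : Set ℂ} {F : E → ℂ} (hB : IsPreconnected B) (h0 : (0 : E) ∈ B)
    (hρ : 0 < ρ) (hδ : 0 < δ) (hf : Continuous f)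
    (hfd : ∀ x, ∀ y ∈ ball x δ, f y ∈ ball (f x) ρ)
    (K : KState B f U ρ δ s V F) {p : ℂ} (hp : ‖p‖ < 1) (hpV : p ∉ V) :
    ∃ V' F', KState B f U ρ δ ((1 + ‖p‖) / (2 * √‖p‖) * s) V' F' := by
  have hV := K.sub
  have hne : ∀ v ∈ V, mob p v ≠ 0 := by
    intro v hv h
    have h3 := mob_inv hp (hV v hv)
    rw [h, mob_zero, neg_neg] at h3
    exact hpV (h3 ▸ hv)
  have hcont : Continuous (fun x => mob p (F x)) :=
    (mob_diff hp).continuousOn.comp_continuous K.cont (fun x => by simpa using hV _ (K.mem x))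
  obtain ⟨r, hr1, hr2⟩ := cont_sqrt hcont (fun x => hne _ (K.mem x))
  set b := r 0 with hb
  have hF0 : F 0 = 0 := K.bd 0 h0
  have hb2 : b ^ 2 = -p := by rw [hb, hr2, hF0, mob_zero]
  have hp0 : p ≠ 0 := by
    rintro rfl
    exact hpV (hF0 ▸ K.mem 0)
  have hb0 : b ≠ 0 := by
    intro h; rw [h] at hb2; apply hp0; simpa using hb2.symm
  have hbn : ‖b‖ ^ 2 = ‖p‖ := by rw [← norm_pow, hb2, norm_neg]
  have hb1 : ‖b‖ < 1 := by nlinarith [norm_nonneg b]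
  have hrB : ∀ x ∈ B, r x = b := by
    have := hB.eq_of_sq_eq (f := r) (g := fun _ => b) hr1.continuousOn continuousOn_const
      (by
        intro x hx
        simp only [Pi.pow_apply]
        rw [hr2, K.bd x hx, mob_zero, hb2]) (fun _ => hb0) h0 rfl
    exact this
  have hlt : ∀ u v : ℂ, v ∈ V → u ^ 2 = mob p v → ‖u‖ < 1 := by
    intro u v hv huv
    have : ‖u‖ ^ 2 < 1 := by
      rw [← norm_pow, huv]; exact mob_lt hp (hV v hv)
    nlinarith [norm_nonneg u]
  have hnb : ‖-b‖ < 1 := by simpa using hb1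
  have hnp : ‖-p‖ < 1 := by simpa using hp
  have hq : ∀ u v : ℂ, v ∈ V → u ^ 2 = mob p v → mob (-p) (mob (-b) (mob b u) ^ 2) = v := by
    intro u v hv huv
    rw [mob_inv hb1 (hlt u v hv huv), huv, mob_inv hp (hV v hv)]
  set V' : Set ℂ := {w | ‖w‖ < 1 ∧ mob (-p) (mob (-b) w ^ 2) ∈ V} with hV'
  have hmem : ∀ u v : ℂ, v ∈ V → u ^ 2 = mob p v → mob b u ∈ V' := by
    intro u v hv huv
    refine ⟨mob_lt hb1 (hlt u v hv huv), ?_⟩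
    rw [hq u v hv huv]; exact hv
  refine ⟨V', fun x => mob b (r x), ?_⟩
  constructor
  · exact fun v hv => hv.1
  · exact (mob_diff hb1).continuousOn.comp_continuous hr1
      (fun x => by simpa using hlt _ _ (K.mem x) (hr2 x))
  · exact fun x => hmem _ _ (K.mem x) (hr2 x)
  · intro x hx
    simp only [hrB x hx, mob_self]
  · intro hN
    apply K.null
    have := hN.map (q := fun w => mob (-p) (mob (-b) w ^ 2)) (W := V) (by
      have c1 : ContinuousOn (mob (-b)) V' :=
        (mob_diff hnb).continuousOn.mono (fun w hw => by simpa using hw.1)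
      refine (mob_diff hnp).continuousOn.comp (c1.pow 2) ?_
      intro w hw
      have := mob_lt hnb hw.1
      simp only [mem_ball, dist_zero_right, norm_pow]
      nlinarith [norm_nonneg (mob (-b) w)]) (fun w hw => hw.2)
    convert this using 1
    · ext x; exact (hq _ _ (K.mem x) (hr2 x)).symm
    · rw [mob_zero, neg_neg, hb2, mob_self]
  · intro x
    obtain ⟨L, hL1, hL2, hL3⟩ := K.loc x
    have hx : x ∈ ball x δ := mem_ball_self hδ
    obtain ⟨G, g1, g2, g3⟩ := holo_root (u := r x) hρ hV hp hpV hL1 hL2 (by rw [hr2, hL3 x hx])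
    refine ⟨fun z => mob b (G z), ?_, ?_, ?_⟩
    · exact (mob_diff hb1).comp g1 (fun w hw => by simpa using hlt _ _ (hL2 hw) (g2 w hw))
    · exact fun w hw => hmem _ _ (hL2 hw) (g2 w hw)
    · have := (convex_ball x δ).isPreconnected.eq_of_sq_eq (f := fun y => G (f y)) (g := r)
        (g1.continuousOn.comp hf.continuousOn (fun y hy => hfd x y hy)) hr1.continuousOn
        (by
          intro y hy
          simp only [Pi.pow_apply]
          rw [hr2, hL3 y hy, g2 _ (hfd x y hy)]) (by
          intro y hy h
          have := hr2 y
          rw [h] at this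
          exact hne _ (K.mem y) (by rw [← this]; simp)) hx g3
      intro y hy
      simp only
      rw [show G (f y) = r y from this hy]
  · obtain ⟨L, hL1, hL2, hL3, hL4⟩ := K.der
    obtain ⟨G, g1, g2, g3⟩ := holo_root (u := b) hρ hV hp hpV hL1 hL2 (by rw [hL3, mob_zero, hb2])
    have hc : (0 : ℂ) ∈ ball (0 : ℂ) ρ := mem_ball_self hρ
    refine ⟨fun z => mob b (G z), ?_, ?_, ?_, ?_⟩
    · exact (mob_diff hb1).comp g1 (fun w hw => by simpa using hlt _ _ (hL2 hw) (g2 w hw))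
    · exact fun w hw => hmem _ _ (hL2 hw) (g2 w hw)
    · simp only [g3, mob_self]
    · have dG : HasDerivAt G (deriv G 0) 0 :=
        ((g1 0 hc).differentiableAt (isOpen_ball.mem_nhds hc)).hasDerivAt
      have dL : HasDerivAt L (deriv L 0) 0 :=
        ((hL1 0 hc).differentiableAt (isOpen_ball.mem_nhds hc)).hasDerivAt
      have d1 : HasDerivAt (fun z => G z ^ 2) (2 * b * deriv G 0) 0 := by
        refine (dG.pow 2).congr_deriv ?_
        rw [g3]; ring
      have d2 : HasDerivAt (fun z => mob p (L z)) ((1 - (‖p‖ : ℂ) ^ 2) * deriv L 0) 0 := by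
        have := mob_deriv_zero p
        rw [← hL3] at this
        exact this.comp 0 dL
      have d3 : HasDerivAt (fun z => G z ^ 2) ((1 - (‖p‖ : ℂ) ^ 2) * deriv L 0) 0 := by
        refine d2.congr_of_eventuallyEq ?_
        filter_upwards [isOpen_ball.mem_nhds hc] with z hz
        exact g2 z hz
      have e1 := d1.unique d3
      have d4 : HasDerivAt (fun z => mob b (G z)) (1 / (1 - (‖b‖ : ℂ) ^ 2) * deriv G 0) 0 := by
        have := mob_deriv_self hb1
        rw [← g3] at this
        have := this.comp 0 dG
        rw [g3] at this
        exact this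
      rw [d4.deriv]
      have hbpos : 0 < ‖b‖ := norm_pos_iff.mpr hb0
      have hbp : 0 < 1 - ‖b‖ ^ 2 := by nlinarith
      have e2 : 2 * ‖b‖ * ‖deriv G 0‖ = (1 - ‖p‖ ^ 2) * ‖deriv L 0‖ := by
        have := congrArg norm e1
        have hh : ‖(1 - (‖p‖ : ℂ) ^ 2)‖ = 1 - ‖p‖ ^ 2 := by
          rw [show (1 - (‖p‖ : ℂ) ^ 2) = ((1 - ‖p‖ ^ 2 : ℝ) : ℂ) by push_cast; ring,
            Complex.norm_of_nonneg]
          nlinarith [norm_nonneg p]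
        rw [norm_mul, norm_mul, norm_mul, hh] at this
        simpa using this
      have e3 : ‖1 / (1 - (‖b‖ : ℂ) ^ 2)‖ = 1 / (1 - ‖b‖ ^ 2) := by
        rw [show (1 - (‖b‖ : ℂ) ^ 2) = ((1 - ‖b‖ ^ 2 : ℝ) : ℂ) by push_cast; ring,
          norm_div, Complex.norm_of_nonneg hbp.le, norm_one]
      rw [norm_mul, e3]
      have e4 : √‖p‖ = ‖b‖ := by rw [← hbn, Real.sqrt_sq hbpos.le]
      rw [e4, ← hbn]
      rw [← hbn] at e2
      have e5 : ‖deriv G 0‖ = (1 - (‖b‖ ^ 2) ^ 2) * ‖deriv L 0‖ / (2 * ‖b‖) := by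
        rw [← e2]; field_simp
      rw [e5]
      have e6 : 1 / (1 - ‖b‖ ^ 2) * ((1 - (‖b‖ ^ 2) ^ 2) * ‖deriv L 0‖ / (2 * ‖b‖))
        = (1 + ‖b‖ ^ 2) / (2 * ‖b‖) * ‖deriv L 0‖ := by
        field_simp
        ring
      rw [e6]
      gcongr

lemma KState.bound {E : Type*} [NormedAddCommGroup E] [NormedSpace ℝ E] {B : Set E} {f : E → ℂ}
    {U : Set ℂ} {ρ δ s : ℝ} {V : Set ℂ} {F : E → ℂ} (h0 : (0 : E) ∈ B)
    (hρ : 0 < ρ) (hfd : ∀ x, ∀ y ∈ ball x δ, f y ∈ ball (f x) (ρ / 2))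
    (K : KState B f U ρ δ s V F) (M : ℕ) (x : E) (hx : ‖x‖ < M * δ) :
    (3 / 16 : ℝ) ^ M ≤ 1 - ‖F x‖ ^ 2 := by
  have hM : 0 < (M : ℝ) := by
    by_contra h
    have : M = 0 := by simpa using h
    subst this
    simp at hx
    linarith [norm_nonneg x]
  have key : ∀ i : ℕ, (3 / 16 : ℝ) ^ i ≤ 1 - ‖F ((i / M : ℝ) • x)‖ ^ 2 := by
    intro i
    induction i with
    | zero => simp [K.bd 0 h0]
    | succ i ih =>
      obtain ⟨L, h1, h2, h3⟩ := K.loc ((i / M : ℝ) • x)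
      have hδ : 0 < δ := by
        by_contra h
        have : (M : ℝ) * δ ≤ 0 := mul_nonpos_of_nonneg_of_nonpos hM.le (not_lt.mp h)
        linarith [norm_nonneg x]
      have hy : (((i + 1 : ℕ) : ℝ) / M) • x ∈ ball ((i / M : ℝ) • x) δ := by
        rw [mem_ball, dist_eq_norm, ← sub_smul, norm_smul]
        have : ((i + 1 : ℕ) : ℝ) / M - i / M = 1 / M := by push_cast; ring
        rw [this, Real.norm_of_nonneg (by positivity), div_mul_eq_mul_div, one_mul,
          div_lt_iff₀ hM]
        linarith
      have := schwarz_pick h1 (fun w hw => K.sub _ (h2 hw)) hρ (hfd _ _ hy)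
      rw [← h3 _ hy, ← h3 _ (mem_ball_self hδ)] at this
      refine le_trans ?_ this
      rw [pow_succ]
      linarith
  have := key M
  rwa [div_self hM.ne', one_smul] at this

lemma planar_disc {E : Type*} [NormedAddCommGroup E] [NormedSpace ℝ E] [ProperSpace E] {B : Set E}
    (hB : IsPreconnected B) (h0 : (0 : E) ∈ B) {M : ℝ} (hM : ∀ x, M ≤ ‖x‖ → x ∈ B)
    {U : Set ℂ} (hU : IsOpen U) (hU1 : ∀ u ∈ U, ‖u‖ < 1) {f : E → ℂ} (hf : Continuous f)
    (hfU : ∀ x, f x ∈ U) (hfB : ∀ x ∈ B, f x = 0) : NullIn B U f 0 := by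
  have hsupp : HasCompactSupport f := by
    refine HasCompactSupport.intro (isCompact_closedBall (0 : E) M) ?_
    intro x hx
    apply hfB; apply hM
    simp at hx; exact hx.le
  have huc : UniformContinuous f := hf.uniformContinuous_of_tendsto_cocompact
    hsupp.is_zero_at_infty
  have hcomp : IsCompact (range f) := by
    have : range f = f '' closedBall 0 M ∪ {0} := by
      ext z; constructor
      · rintro ⟨x, rfl⟩
        by_cases hx : ‖x‖ ≤ M
        · exact Or.inl ⟨x, by simpa using hx, rfl⟩
        · exact Or.inr (hfB x (hM x (not_le.mp hx).le))
      · rintro (⟨x, -, rfl⟩ | h)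
        · exact ⟨x, rfl⟩
        · exact ⟨0, by rw [hfB 0 h0]; exact h.symm⟩
    rw [this]
    exact ((isCompact_closedBall 0 M).image hf).union isCompact_singleton
  obtain ⟨ρ, hρ, hρU⟩ := hcomp.exists_thickening_subset_open hU (range_subset_iff.mpr hfU)
  have hρU' : ∀ x, ball (f x) ρ ⊆ U := fun x z hz =>
    hρU (mem_thickening_iff.mpr ⟨f x, mem_range_self x, hz⟩)
  obtain ⟨δ, hδ, hδf⟩ := Metric.uniformContinuous_iff.mp huc (ρ / 2) (by positivity)
  have hfd : ∀ x, ∀ y ∈ ball x δ, f y ∈ ball (f x) (ρ / 2) := fun x y hy => hδf hy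
  have hfd' : ∀ x, ∀ y ∈ ball x δ, f y ∈ ball (f x) ρ := fun x y hy =>
    ball_subset_ball (by linarith) (hfd x y hy)
  obtain ⟨N, hN⟩ := exists_nat_gt (M / δ)
  have hN' : M < N * δ := by rwa [div_lt_iff₀ hδ] at hN
  set R : ℝ := √(1 - (3 / 16) ^ N) with hR
  have hp1 : (0 : ℝ) < (3 / 16) ^ N := by positivity
  have hp2 : (3 / 16 : ℝ) ^ N ≤ 1 := pow_le_one₀ (by norm_num) (by norm_num)
  have hR0 : 0 ≤ R := Real.sqrt_nonneg _
  have hRsq : R ^ 2 = 1 - (3 / 16) ^ N := Real.sq_sqrt (by linarith)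
  have hR1 : R < 1 := by nlinarith
  have hFR : ∀ s V F, KState B f U ρ δ s V F → ∀ x, ‖F x‖ ≤ R := by
    intro s V F K x
    by_cases hx : x ∈ B
    · rw [K.bd x hx]; simpa using hR0
    · have hx' : ‖x‖ < M := by
        by_contra h; exact hx (hM x (not_lt.mp h))
      have := K.bound h0 hρ hfd N x (by linarith)
      apply abs_le_of_sq_le_sq' _ hR0 |>.2
      rw [hRsq]; linarith
  by_contra hcon
  have hball : ∀ s V F, KState B f U ρ δ s V F → ∃ p, ‖p‖ ≤ R ∧ p ∉ V := by
    intro s V F K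
    by_contra! hall
    apply hcon
    apply K.null
    refine ⟨fun q => ((1 - (q.1 : ℝ) : ℝ) : ℂ) * F q.2, ?_, ?_, ?_, ?_, ?_⟩
    · have := K.cont
      fun_prop
    · intro q
      apply hall
      rw [norm_mul, Complex.norm_of_nonneg (by linarith [q.1.2.2])]
      have h1 := hFR s V F K q.2
      have h2 := q.1.2.1
      have h3 := q.1.2.2
      nlinarith [norm_nonneg (F q.2)]
    · intro x; simp
    · intro x; simp
    · intro t x hx; simp [K.bd x hx]
  -- growth factor
  obtain ⟨p0, -, -⟩ : ∃ p : ℂ, ‖p‖ ≤ R ∧ True := ⟨0, by simpa using hR0, trivial⟩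
  have hR' : 0 ≤ √R := Real.sqrt_nonneg _
  set μ : ℝ := (√R) with hμ
  have hμR : μ ^ 2 = R := Real.sq_sqrt hR0
  have hμ1 : μ < 1 := by nlinarith
  set lam : ℝ := 1 + (1 - μ) ^ 2 / 2 with hlam
  have hlam1 : 1 < lam := by
    have : 0 < (1 - μ) ^ 2 := by have : 0 < 1 - μ := by linarith
                                 positivity
    linarith
  have hgrow : ∀ n : ℕ, ∃ V F s, lam ^ n ≤ s ∧ KState B f U ρ δ s V F := by
    intro n
    induction n with
    | zero =>
      refine ⟨U, f, 1, by simp, hU1, hf, hfU, hfB, id, ?_, ?_⟩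
      · intro x
        exact ⟨id, differentiableOn_id, fun z hz => hρU' x hz, fun y _ => rfl⟩
      · refine ⟨id, differentiableOn_id, fun z hz => hρU' 0 (by rw [hfB 0 h0]; exact hz), rfl, ?_⟩
        simp
    | succ n ih =>
      obtain ⟨V, F, s, hs, K⟩ := ih
      obtain ⟨p, hpR, hpV⟩ := hball s V F K
      obtain ⟨V', F', K'⟩ := K.step hB h0 hρ hδ hf hfd' (by linarith) hpV
      refine ⟨V', F', _, ?_, K'⟩
      rw [pow_succ, mul_comm]
      have hp0 : p ≠ 0 := by
        rintro rfl
        exact hpV (K.bd 0 h0 ▸ K.mem 0)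
      have hb : 0 < √‖p‖ := Real.sqrt_pos.mpr (norm_pos_iff.mpr hp0)
      have hb2 : √‖p‖ ^ 2 = ‖p‖ := Real.sq_sqrt (norm_nonneg p)
      have hbμ : √‖p‖ ≤ μ := Real.sqrt_le_sqrt hpR
      have hl0 : 0 ≤ lam ^ n := by positivity
      have : lam ≤ (1 + ‖p‖) / (2 * √‖p‖) := by
        have k0 : 1 + ‖p‖ = 1 + √‖p‖ ^ 2 := by rw [hb2]
        rw [le_div_iff₀ (by positivity), hlam, k0]
        have hμ1' : μ ≤ 1 := by linarith
        clear_value μ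
        generalize √‖p‖ = β at hb hbμ
        have k1 : (1 - μ) ^ 2 ≤ (1 - β) ^ 2 := by nlinarith
        nlinarith [sq_nonneg (1 - μ), mul_nonneg (sq_nonneg (1 - μ)) (sub_nonneg.mpr (hbμ.trans hμ1'))]
      exact mul_le_mul this hs hl0 (by positivity)
  obtain ⟨n, hn⟩ := pow_unbounded_of_one_lt (1 / ρ) hlam1
  obtain ⟨V, F, s, hs, K⟩ := hgrow n
  obtain ⟨L, l1, l2, l3, l4⟩ := K.der
  have := Complex.norm_deriv_le_div_of_mapsTo_ball (R₂ := 1) l1 (by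
    intro z hz
    rw [l3, mem_closedBall, dist_zero_right]
    exact (K.sub _ (l2 hz)).le) hρ
  linarith

/-- Every planar open set is aspherical. -/
lemma planar {E : Type*} [NormedAddCommGroup E] [NormedSpace ℝ E] [ProperSpace E] {B : Set E}
    (hB : IsPreconnected B) (h0 : (0 : E) ∈ B) {M : ℝ} (hM : ∀ x, M ≤ ‖x‖ → x ∈ B)
    {U : Set ℂ} (hU : IsOpen U) {f : E → ℂ} (hf : Continuous f)
    (hfU : ∀ x, f x ∈ U) {c : ℂ} (hfB : ∀ x ∈ B, f x = c) : NullIn B U f c := by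
  have hbd : ∃ C, 0 < C ∧ ∀ x, ‖f x - c‖ < C := by
    obtain ⟨C, hC⟩ := (isCompact_closedBall (0 : E) M).exists_bound_of_continuousOn
      (f := fun x => f x - c) (by fun_prop)
    refine ⟨max C 0 + 1, by positivity, fun x => ?_⟩
    by_cases hx : ‖x‖ ≤ M
    · have := hC x (by simpa using hx)
      have := le_max_left C 0
      linarith
    · rw [hfB x (hM x (not_le.mp hx).le), sub_self, norm_zero]
      positivity
  obtain ⟨C, hC, hCf⟩ := hbd
  have hC0 : (C : ℂ) ≠ 0 := by exact_mod_cast hC.ne'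
  have := planar_disc hB h0 hM (U := (fun z : ℂ => (C : ℂ) * z + c) ⁻¹' U ∩ ball 0 1)
    ((hU.preimage (by fun_prop)).inter isOpen_ball) (fun u hu => by simpa using hu.2)
    (f := fun x => (f x - c) / C) (by fun_prop) (by
      intro x
      constructor
      · simp only [mem_preimage]
        rw [mul_div_cancel₀ _ hC0, sub_add_cancel]
        exact hfU x
      · simp only [mem_ball, dist_zero_right, norm_div, Complex.norm_of_nonneg hC.le]
        rw [div_lt_one hC]
        exact hCf x) (by intro x hx; simp [hfB x hx])
  have h2 := this.map (q := fun z : ℂ => (C : ℂ) * z + c) (W := U) (by fun_prop)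
    (fun z hz => hz.1)
  convert h2 using 1
  · ext x; field_simp; ring
  · ring


/-- Fibrewise homeomorphisms of the plane carrying `a τ` to `b τ`, trivial over `D`. -/
def Triv {T : Type*} [TopologicalSpace T] {n : ℕ} (D : Set T) (a b : T → Fin n → ℂ) : Prop :=
  ∃ Φ Ψ : T × ℂ → ℂ, Continuous Φ ∧ Continuous Ψ ∧ (∀ τ z, Ψ (τ, Φ (τ, z)) = z) ∧
    (∀ τ z, Φ (τ, Ψ (τ, z)) = z) ∧ (∀ τ i, Φ (τ, a τ i) = b τ i) ∧ ∀ τ ∈ D, ∀ z, Φ (τ, z) = z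

lemma Triv.refl {T : Type*} [TopologicalSpace T] {n : ℕ} (D : Set T) (a : T → Fin n → ℂ) :
    Triv D a a :=
  ⟨Prod.snd, Prod.snd, continuous_snd, continuous_snd, by simp, by simp, by simp, by simp⟩

lemma Triv.trans {T : Type*} [TopologicalSpace T] {n : ℕ} {D : Set T} {a b c : T → Fin n → ℂ}
    (h : Triv D a b) (h' : Triv D b c) : Triv D a c := by
  obtain ⟨Φ, Ψ, h1, h2, h3, h4, h5, h6⟩ := h
  obtain ⟨Φ', Ψ', k1, k2, k3, k4, k5, k6⟩ := h'
  refine ⟨fun p => Φ' (p.1, Φ p), fun p => Ψ (p.1, Ψ' p), by fun_prop, by fun_prop, ?_, ?_, ?_, ?_⟩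
  · intro τ z; simp [k3, h3]
  · intro τ z; simp [k4, h4]
  · intro τ i; simp [h5, k5]
  · intro τ hτ z; simp [h6 τ hτ, k6 τ hτ]

lemma Triv.single {T : Type*} [TopologicalSpace T] {n : ℕ} {D : Set T} {a b : T → Fin n → ℂ}
    (ha : Continuous a) (hb : Continuous b) {δ ε : ℝ} (hδ : 0 < δ) (hε : 0 ≤ ε)
    (hne : n * ε / δ ≤ 1 / 2) (hab : ∀ τ i, ‖b τ i - a τ i‖ ≤ ε)
    (hsep : ∀ τ, a τ = b τ ∨ ∀ i j, i ≠ j → δ ≤ ‖a τ i - a τ j‖)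
    (hD : ∀ τ ∈ D, a τ = b τ) : Triv D a b := by
  let u : T → ℂ → ℂ := fun τ z =>
    ∑ i, ((max 0 (1 - ‖z - a τ i‖ / δ) : ℝ) : ℂ) * (b τ i - a τ i)
  have hu : Continuous (fun p : T × ℂ => u p.1 p.2) := by
    simp only [u]
    fun_prop
  have hulip : ∀ τ z w, ‖u τ z - u τ w‖ ≤ 1 / 2 * ‖z - w‖ := by
    intro τ z w
    simp only [u]
    rw [← Finset.sum_sub_distrib]
    calc _ ≤ ∑ i : Fin n, (ε / δ) * ‖z - w‖ := by
          refine norm_sum_le_of_le _ fun i _ => ?_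
          rw [← sub_mul, norm_mul, ← Complex.ofReal_sub, Complex.norm_real, Real.norm_eq_abs]
          have h1 : |max 0 (1 - ‖z - a τ i‖ / δ) - max 0 (1 - ‖w - a τ i‖ / δ)| ≤ ‖z - w‖ / δ := by
            refine (abs_max_sub_max_le_max _ _ _ _).trans ?_
            rw [sub_self, abs_zero, max_eq_right (abs_nonneg _)]
            have : (1 - ‖z - a τ i‖ / δ) - (1 - ‖w - a τ i‖ / δ)
              = (‖w - a τ i‖ - ‖z - a τ i‖) / δ := by ring
            rw [this, abs_div, abs_of_pos hδ]
            gcongr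
            refine (abs_norm_sub_norm_le _ _).trans ?_
            rw [sub_sub_sub_cancel_right, norm_sub_rev]
          calc _ ≤ ‖z - w‖ / δ * ε := by gcongr; exact hab τ i
            _ = _ := by ring
      _ = n * ε / δ * ‖z - w‖ := by simp; ring
      _ ≤ _ := by gcongr
  have hueq : ∀ τ, a τ = b τ → ∀ z, u τ z = 0 := by
    intro τ h z
    simp [u, h]
  have hua : ∀ τ i, u τ (a τ i) = b τ i - a τ i := by
    intro τ i
    rcases hsep τ with h | h
    · rw [hueq τ h, h, sub_self]
    · simp only [u]
      rw [Finset.sum_eq_single i]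
      · simp
      · intro j _ hj
        have : 1 - ‖a τ i - a τ j‖ / δ ≤ 0 := by
          rw [sub_nonpos, le_div_iff₀ hδ, one_mul]
          exact h i j hj.symm
        rw [max_eq_left this]; simp
      · simp
  clear_value u
  have hinv : ∀ τ z, ∃ w, w + u τ w = z := by
    intro τ z
    have hc : ContractingWith (1 / 2 : NNReal) (fun w => z - u τ w) := by
      refine ⟨by norm_num, LipschitzWith.of_dist_le_mul fun x y => ?_⟩
      rw [dist_eq_norm, dist_eq_norm, sub_sub_sub_cancel_left, norm_sub_rev x y]
      simpa using hulip τ y x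
    refine ⟨hc.fixedPoint, ?_⟩
    have h := hc.fixedPoint_isFixedPt
    have h' : z - u τ (ContractingWith.fixedPoint _ hc) = ContractingWith.fixedPoint _ hc := h
    linear_combination -h'
  choose v hv using hinv
  have hanti : ∀ τ z w, ‖z - w‖ ≤ 2 * ‖(z + u τ z) - (w + u τ w)‖ := by
    intro τ z w
    have h1 := hulip τ z w
    have h2 : z - w = ((z + u τ z) - (w + u τ w)) - (u τ z - u τ w) := by ring
    have h3 := norm_sub_le ((z + u τ z) - (w + u τ w)) (u τ z - u τ w)
    rw [← h2] at h3
    linarith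
  refine ⟨fun p => p.2 + u p.1 p.2, fun p => v p.1 p.2, continuous_snd.add hu, ?_, ?_, ?_, ?_, ?_⟩
  · rw [continuous_iff_continuousAt]
    rintro ⟨τ, z⟩
    rw [ContinuousAt, tendsto_iff_norm_sub_tendsto_zero]
    have hlim : Tendsto (fun p : T × ℂ => 2 * ‖p.2 - (v τ z + u p.1 (v τ z))‖) (𝓝 (τ, z)) (𝓝 0) := by
      have hc : Continuous (fun p : T × ℂ => 2 * ‖p.2 - (v τ z + u p.1 (v τ z))‖) := by
        have : Continuous (fun p : T × ℂ => u p.1 (v τ z)) :=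
          hu.comp (continuous_fst.prodMk continuous_const)
        exact continuous_const.mul (continuous_snd.sub (continuous_const.add this)).norm
      have := hc.tendsto (τ, z)
      simpa [hv] using this
    refine squeeze_zero (fun _ => norm_nonneg _) (fun p => ?_) hlim
    have := hanti p.1 (v p.1 p.2) (v τ z)
    rwa [hv] at this
  · intro τ z
    have := hanti τ (v τ (z + u τ z)) z
    rw [hv, sub_self, norm_zero, mul_zero] at this
    exact sub_eq_zero.mp (norm_le_zero_iff.mp this)
  · intro τ z; exact hv τ z
  · intro τ i; simp [hua]
  · intro τ hτ z; simp [hueq τ (hD τ hτ)]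

lemma Triv.transport {T : Type*} [PseudoMetricSpace T] {n : ℕ} {D K : Set T} (hK : IsCompact K)
    (G : ℝ → T → Fin n → ℂ) (hG : Continuous (fun p : ℝ × T => G p.1 p.2))
    (hinj : ∀ s τ, Function.Injective (G s τ)) (hGK : ∀ τ ∉ K, ∀ s s', G s τ = G s' τ)
    (hGD : ∀ τ ∈ D, ∀ s s', G s τ = G s' τ) : Triv D (G 0) (G 1) := by
  have hC : IsCompact (Icc (0:ℝ) 1 ×ˢ K) := isCompact_Icc.prod hK
  obtain ⟨δ, hδ, hsep⟩ : ∃ δ : ℝ, 0 < δ ∧ ∀ i j, i ≠ j → ∀ s ∈ Icc (0:ℝ) 1, ∀ τ ∈ K,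
      δ ≤ ‖G s τ i - G s τ j‖ := by
    have key : ∀ i j : Fin n, ∀ᶠ δ in 𝓝[>] (0:ℝ), i ≠ j → ∀ s ∈ Icc (0:ℝ) 1, ∀ τ ∈ K,
      δ ≤ ‖G s τ i - G s τ j‖ := by
      intro i j
      by_cases hij : i = j
      · simp [hij]
      rcases (Icc (0:ℝ) 1 ×ˢ K).eq_empty_or_nonempty with he | hne
      · refine Eventually.of_forall fun δ _ s hs τ hτ => ?_
        exact absurd (show (s, τ) ∈ (Icc (0:ℝ) 1 ×ˢ K) from ⟨hs, hτ⟩) (by simp [he])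
      · have hcont : Continuous (fun p : ℝ × T => ‖G p.1 p.2 i - G p.1 p.2 j‖) := by fun_prop
        obtain ⟨p, hp, hmin⟩ := hC.exists_isMinOn hne hcont.continuousOn
        have hpos : 0 < ‖G p.1 p.2 i - G p.1 p.2 j‖ :=
          norm_pos_iff.mpr (sub_ne_zero.mpr fun h => hij (hinj _ _ h))
        filter_upwards [Ioo_mem_nhdsGT hpos] with δ hδ _ s hs τ hτ
        exact hδ.2.le.trans (hmin (show (s, τ) ∈ (Icc (0:ℝ) 1 ×ˢ K) from ⟨hs, hτ⟩))
    have key2 := (eventually_all.mpr fun i => eventually_all.mpr fun j => key i j).and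
      (self_mem_nhdsWithin (a := (0:ℝ)) (s := Ioi 0))
    obtain ⟨δ, h1, h2⟩ := key2.exists
    exact ⟨δ, h2, h1⟩
  set ε : ℝ := δ / (2 * (n + 1)) with hε
  have hε0 : 0 < ε := by positivity
  have hne : n * ε / δ ≤ 1 / 2 := by
    rw [hε, div_le_iff₀ hδ, mul_div_assoc', div_le_iff₀ (by positivity)]
    nlinarith
  obtain ⟨η, hη, huc⟩ := Metric.uniformContinuousOn_iff.mp
    (hC.uniformContinuousOn_of_continuous hG.continuousOn) ε hε0
  obtain ⟨N, hN⟩ := exists_nat_gt (1 / η)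
  have hN0 : (0:ℝ) < N := lt_trans (by positivity) hN
  have hstep : ∀ j : ℕ, j ≤ N → Triv D (G 0) (G (j / N)) := by
    intro j
    induction j with
    | zero => intro _; simpa using Triv.refl D (G 0)
    | succ j ih =>
      intro hj
      refine (ih (by omega)).trans ?_
      have hj' : ((j:ℝ) + 1) ≤ N := by exact_mod_cast hj
      have m1 : (j:ℝ) / N ∈ Icc (0:ℝ) 1 := ⟨by positivity, by rw [div_le_one hN0]; linarith⟩
      have m2 : ((j + 1 : ℕ):ℝ) / N ∈ Icc (0:ℝ) 1 :=
        ⟨by positivity, by rw [div_le_one hN0]; push_cast; linarith⟩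
      refine Triv.single (δ := δ) (ε := ε) ?_ ?_ hδ hε0.le hne ?_ ?_ (fun τ hτ => hGD τ hτ _ _)
      · exact hG.comp (continuous_const.prodMk continuous_id)
      · exact hG.comp (continuous_const.prodMk continuous_id)
      · intro τ i
        by_cases hτ : τ ∈ K
        · have := huc _ (show (((j + 1 : ℕ):ℝ) / N, τ) ∈ (Icc (0:ℝ) 1 ×ˢ K) from ⟨m2, hτ⟩)
            _ (show ((j:ℝ) / N, τ) ∈ (Icc (0:ℝ) 1 ×ˢ K) from ⟨m1, hτ⟩) (by
              rw [Prod.dist_eq, dist_self, max_eq_left dist_nonneg, Real.dist_eq]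
              have : ((j + 1 : ℕ):ℝ) / N - j / N = 1 / N := by push_cast; ring
              rw [this, abs_of_pos (by positivity)]
              rw [one_div_lt hN0 hη]; exact hN)
          rw [← dist_eq_norm]
          exact (dist_le_pi_dist _ _ i).trans this.le
        · rw [hGK τ hτ ((j + 1 : ℕ) / N) (j / N)]; simpa using hε0.le
      · intro τ
        by_cases hτ : τ ∈ K
        · exact Or.inr fun i j' hij => hsep i j' hij _ m1 τ hτ
        · exact Or.inl (hGK τ hτ _ _)
  have := hstep N le_rfl
  rwa [div_self hN0.ne'] at this


lemma conf_null {E : Type*} [NormedAddCommGroup E] [NormedSpace ℝ E] [ProperSpace E] {B : Set E}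
    (hB : IsPreconnected B) (h0 : (0 : E) ∈ B) {M : ℝ} (hM : ∀ x, M ≤ ‖x‖ → x ∈ B) (n : ℕ) :
    ∀ (f : E → Fin n → ℂ) (c : Fin n → ℂ), Continuous f → (∀ x, Function.Injective (f x)) →
      (∀ x ∈ B, f x = c) → NullIn B {g : Fin n → ℂ | Function.Injective g} f c := by
  induction n with
  | zero =>
    intro f c hf hi hc
    refine ⟨fun p => f p.2, by fun_prop, fun p => hi _, fun x => rfl,
      fun x => Subsingleton.elim _ _, fun t x _ => Subsingleton.elim _ _⟩
  | succ n ih =>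
    intro f c hf hi hc
    obtain ⟨H, hH, Hinj, H0, H1, HB⟩ := ih (fun x => Fin.tail (f x)) (Fin.tail c)
      (by unfold Fin.tail; fun_prop)
      (fun x => (hi x).comp (Fin.succ_injective _)) (fun x hx => by simp [hc x hx])
    let G : ℝ → (unitInterval × E) → Fin n → ℂ := fun s τ =>
      H (projIcc (0:ℝ) 1 zero_le_one (1 - s * (1 - (τ.1 : ℝ))), τ.2)
    have hG : Continuous (fun p : ℝ × (unitInterval × E) => G p.1 p.2) := by
      refine hH.comp (Continuous.prodMk ?_ (by fun_prop))
      exact continuous_projIcc.comp (by fun_prop)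
    have hG0 : ∀ τ, G 0 τ = Fin.tail c := by
      intro τ
      simp only [G, zero_mul, sub_zero]
      rw [projIcc_right]
      exact H1 _
    have hG1 : ∀ τ, G 1 τ = H τ := by
      intro τ
      simp only [G, one_mul, sub_sub_cancel]
      rw [projIcc_val]
    let D : Set (unitInterval × E) := {τ | τ.1 = 1 ∨ τ.2 ∈ B}
    have hGD : ∀ τ ∈ D, ∀ s, G s τ = Fin.tail c := by
      rintro ⟨t, x⟩ (h | h) s
      · have h : t = 1 := h
        subst h
        simp only [G, Set.Icc.coe_one, sub_self, mul_zero, sub_zero]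
        rw [projIcc_right]
        exact H1 _
      · exact HB _ _ h
    obtain ⟨Φ, Ψ, hΦ, hΨ, h1, h2, h3, h4⟩ := Triv.transport (D := D)
      (K := univ ×ˢ closedBall (0 : E) M) (isCompact_univ.prod (isCompact_closedBall _ _)) G hG
      (fun s τ => Hinj _) (fun τ hτ s s' => by
        have : τ ∈ D := by
          right
          apply hM
          simp at hτ
          exact hτ.le
        rw [hGD τ this, hGD τ this]) (fun τ hτ s s' => by rw [hGD τ hτ, hGD τ hτ])
    simp only [hG0, hG1] at h3
    have h4' : ∀ τ ∈ D, ∀ z, Ψ (τ, z) = z := by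
      intro τ hτ z
      have := h1 τ z
      rwa [h4 τ hτ] at this
    obtain ⟨W, hW, WU, W0, W1, WB⟩ := planar hB h0 hM (U := (range (Fin.tail c))ᶜ)
      (finite_range _).isClosed.isOpen_compl (f := fun x => Ψ ((0, x), f x 0)) (c := c 0)
      (by fun_prop) (by
        rintro x ⟨i, hi'⟩
        have : Φ ((0, x), Fin.tail c i) = f x 0 := by rw [hi', h2]
        rw [h3, H0] at this
        exact Fin.succ_ne_zero i (hi x this)) (by
        intro x hx
        rw [h4' _ (Or.inr hx), hc x hx])
    refine ⟨fun p => Fin.cons (Φ (p, W p)) (H p), ?_, ?_, ?_, ?_, ?_⟩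
    · refine continuous_pi fun i => ?_
      refine Fin.cases ?_ (fun j => ?_) i
      · simp only [Fin.cons_zero]; fun_prop
      · simp only [Fin.cons_succ]; fun_prop
    · intro p
      rw [Set.mem_ofPred_eq, Fin.cons_injective_iff]
      refine ⟨?_, Hinj p⟩
      rintro ⟨i, hi'⟩
      rw [← h3] at hi'
      have := congrArg (fun z => Ψ (p, z)) hi'
      simp only [h1] at this
      exact WU p ⟨i, this⟩
    · intro x
      simp only [W0, h2, H0]
      exact Fin.cons_self_tail _
    · intro x
      simp only [W1, H1]
      rw [h4 _ (Or.inl rfl)]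
      exact Fin.cons_self_tail _
    · intro t x hx
      simp only [WB t x hx, HB t x hx]
      rw [h4 _ (Or.inr hx)]
      exact Fin.cons_self_tail _


lemma isOpen_inj (n : ℕ) : IsOpen {f : Fin n → ℂ | Function.Injective f} := by
  have : {f : Fin n → ℂ | Function.Injective f} =
      ⋂ i, ⋂ j, ⋂ (_ : i ≠ j), {f : Fin n → ℂ | f i ≠ f j} := by
    ext f
    simp only [Set.mem_ofPred_eq, mem_iInter, Function.Injective]
    exact ⟨fun h i j hij he => hij (h he), fun h i j he => by_contra fun hij => h i j hij he⟩
  rw [this]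
  refine isOpen_iInter_of_finite fun i => isOpen_iInter_of_finite fun j =>
    isOpen_iInter_of_finite fun _ => ?_
  exact isOpen_ne_fun (continuous_apply i) (continuous_apply j)

/-- The permutation action. -/
@[reducible] def confAction (n : ℕ) : MulAction (Equiv.Perm (Fin n)) (Conf n) where
  smul σ f := ⟨f.1 ∘ (σ⁻¹ : Equiv.Perm (Fin n)), f.2.comp (Equiv.injective _)⟩
  one_smul f := rfl
  mul_smul σ τ f := by
    apply Subtype.ext
    change f.1 ∘ ((σ * τ)⁻¹ : Equiv.Perm (Fin n)) =
      (f.1 ∘ (τ⁻¹ : Equiv.Perm (Fin n))) ∘ (σ⁻¹ : Equiv.Perm (Fin n))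
    rw [mul_inv_rev]
    rfl

lemma conf_covering (n : ℕ) : IsCoveringMap (Quot.mk (permRel n)) := by
  let := confAction n
  have hs : ∀ (σ : Equiv.Perm (Fin n)) (f : Conf n) i, (σ • f).1 i = f.1 (σ⁻¹ i) :=
    fun _ _ _ => rfl
  have : ContinuousConstSMul (Equiv.Perm (Fin n)) (Conf n) := by
    refine ⟨fun σ => ?_⟩
    refine Continuous.subtype_mk ?_ _
    exact continuous_pi fun i => (continuous_apply _).comp continuous_subtype_val
  have : LocallyCompactSpace (Conf n) := (isOpen_inj n).locallyCompactSpace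
  have : IsCancelSMul (Equiv.Perm (Fin n)) (Conf n) := by
    refine isCancelSMul_iff_eq_one_of_smul_eq.mpr fun σ f h => ?_
    rw [← inv_eq_one]
    ext i
    have : (σ • f).1 i = f.1 i := by rw [h]
    rw [hs] at this
    rw [f.2 this]; rfl
  have hsm : ∀ (σ : Equiv.Perm (Fin n)) (f : Conf n), permRel n f (σ • f) := fun σ f => ⟨σ⁻¹, rfl⟩
  refine (Topology.IsQuotientMap.isQuotientCoveringMap_of_properlyDiscontinuousSMul
    (G := Equiv.Perm (Fin n)) (isQuotientMap_quot_mk (r := permRel n)) ?_).isCoveringMap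
  intro e₁ e₂
  constructor
  · intro h
    rw [Quot.eq] at h
    rw [← MulAction.orbitRel_apply]
    induction h with
    | rel x y h =>
      obtain ⟨σ, h⟩ := h
      refine ⟨σ, ?_⟩
      apply Subtype.ext
      funext i
      change y.1 (σ⁻¹ i) = x.1 i
      rw [h]; simp
    | refl x => exact Setoid.refl' _ x
    | symm x y _ h => exact Setoid.symm' _ h
    | trans x y z _ _ h h' => exact Setoid.trans' _ h h'
  · rintro ⟨σ, rfl⟩
    exact (Quot.sound (hsm σ e₂)).symm

lemma conf_pathConnected (n : ℕ) : PathConnectedSpace (Conf n) := by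
  have : Nonempty (Conf n) := ⟨⟨fun i => ((i : ℕ) : ℂ), fun i j h => by
    simpa [Fin.ext_iff] using h⟩⟩
  refine ⟨inferInstance, fun a b => ?_⟩
  let S : Set ℂ := ⋃ i, ⋃ j, ⋃ (_ : i ≠ j),
    {l : ℂ | a.1 i + l * (b.1 i - a.1 i) = a.1 j + l * (b.1 j - a.1 j)}
  have hS : S.Countable := by
    refine countable_iUnion fun i => countable_iUnion fun j => countable_iUnion fun hij => ?_
    refine Set.Subsingleton.countable ?_
    intro l hl m hm
    have hl : a.1 i + l * (b.1 i - a.1 i) = a.1 j + l * (b.1 j - a.1 j) := hl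
    have hm : a.1 i + m * (b.1 i - a.1 i) = a.1 j + m * (b.1 j - a.1 j) := hm
    have h1 : (l - m) * ((b.1 i - a.1 i) - (b.1 j - a.1 j)) = 0 := by linear_combination hl - hm
    rcases mul_eq_zero.mp h1 with h | h
    · exact sub_eq_zero.mp h
    · exfalso
      apply hij
      apply a.2
      linear_combination hl - l * h
  have hmem : ∀ l ∈ Sᶜ, Function.Injective (fun i => a.1 i + l * (b.1 i - a.1 i)) := by
    intro l hl i j h
    by_contra hij
    apply hl
    simp only [S, mem_iUnion]
    exact ⟨i, j, hij, h⟩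
  have hpc := hS.isPathConnected_compl_of_one_lt_rank (by rw [Complex.rank_real_complex]; norm_num)
  have m0 : (0:ℂ) ∈ Sᶜ := by
    simp only [S, mem_compl_iff, mem_iUnion, not_exists]
    intro i j hij h
    have h : a.1 i + 0 * (b.1 i - a.1 i) = a.1 j + 0 * (b.1 j - a.1 j) := h
    exact hij (a.2 (by linear_combination h))
  have m1 : (1:ℂ) ∈ Sᶜ := by
    simp only [S, mem_compl_iff, mem_iUnion, not_exists]
    intro i j hij h
    have h : a.1 i + 1 * (b.1 i - a.1 i) = a.1 j + 1 * (b.1 j - a.1 j) := h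
    exact hij (b.2 (by linear_combination h))
  obtain ⟨γ, hγ⟩ := hpc.joinedIn 0 m0 1 m1
  refine ⟨⟨⟨fun t => ⟨fun i => a.1 i + γ t * (b.1 i - a.1 i), hmem _ (hγ t)⟩, ?_⟩, ?_, ?_⟩⟩
  · refine Continuous.subtype_mk ?_ _
    fun_prop
  · apply Subtype.ext; funext i; simp
  · apply Subtype.ext; funext i; simp

/-- Outside of the open unit cube. -/
def outer (k : ℕ) : Set (Fin k → ℝ) := {y | ∃ i, y i ≤ 0 ∨ 1 ≤ y i}

lemma outer_preconnected {k : ℕ} (hk : 2 ≤ k) : IsPreconnected (outer k) := by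
  refine isPreconnected_of_forall (0 : Fin k → ℝ) fun y hy => ?_
  obtain ⟨i, hi⟩ := hy
  have : Nontrivial (Fin k) := Fin.nontrivial_iff_two_le.mpr hk
  obtain ⟨j, hj⟩ := exists_ne i
  refine ⟨range (fun s : ℝ => Function.update y j s) ∪ {z | z j = 0}, ?_, ?_, ?_, ?_⟩
  · rintro z (⟨s, rfl⟩ | hz)
    · exact ⟨i, by simpa [Function.update_of_ne hj.symm] using hi⟩
    · exact ⟨j, Or.inl (le_of_eq hz)⟩
  · exact Or.inr rfl
  · exact Or.inl ⟨y j, by simp⟩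
  · refine IsPreconnected.union (Function.update y j 0) ⟨0, rfl⟩ (by simp) ?_ ?_
    · exact isPreconnected_range (by fun_prop)
    · refine Convex.isPreconnected ?_
      intro z hz w hw a b _ _ _
      have hz : z j = 0 := hz
      have hw : w j = 0 := hw
      change a * z j + b * w j = 0
      rw [hz, hw]; ring

lemma outer_big {k : ℕ} (hk : 2 ≤ k) (x : Fin k → ℝ) (hx : 1 ≤ ‖x‖) : x ∈ outer k := by
  by_contra h
  simp only [outer, Set.mem_ofPred_eq, not_exists, not_or, not_le] at h
  have : ‖x‖ < 1 := by
    rw [pi_norm_lt_iff one_pos]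
    intro i
    rw [Real.norm_eq_abs, abs_of_pos (h i).1]
    exact (h i).2
  linarith

lemma UConf_null (n k : ℕ) (hk : 2 ≤ k) (x : UConf n) (f : GenLoop (Fin k) (UConf n) x) :
    GenLoop.Homotopic f GenLoop.const := by
  let cl : (Fin k → ℝ) → (Fin k → unitInterval) := fun y i => projIcc (0:ℝ) 1 zero_le_one (y i)
  have hcl : Continuous cl :=
    continuous_pi fun i => continuous_projIcc.comp (continuous_apply i)
  have hclB : ∀ y ∈ outer k, cl y ∈ Cube.boundary (Fin k) := by
    rintro y ⟨i, hi | hi⟩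
    · exact ⟨i, Or.inl (projIcc_of_le_left _ hi)⟩
    · exact ⟨i, Or.inr (projIcc_of_right_le _ hi)⟩
  have h0 : (0 : Fin k → ℝ) ∈ outer k := ⟨⟨0, by omega⟩, Or.inl le_rfl⟩
  have cov := conf_covering n
  obtain ⟨c, rfl⟩ := Quot.exists_rep x
  have hfB : ∀ y ∈ outer k, f (cl y) = Quot.mk _ c := fun y hy => f.2 _ (hclB y hy)
  obtain ⟨F, ⟨F0, hF⟩, -⟩ := cov.existsUnique_continuousMap_lifts
    (f.1.comp ⟨cl, hcl⟩) (0 : Fin k → ℝ) c (hfB 0 h0).symm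
  have hF' : ∀ y, Quot.mk _ (F y) = f (cl y) := fun y => congrFun hF y
  have hFB : ∀ y ∈ outer k, F y = c := by
    intro y hy
    rw [← F0]
    refine cov.constOn_of_comp (outer_preconnected hk) F.continuous.continuousOn ?_ hy h0
    intro a ha b hb
    rw [hF', hF', hfB a ha, hfB b hb]
  obtain ⟨H, h1, h2, h3, h4, h5⟩ := conf_null (outer_preconnected hk) h0 (outer_big hk) n
    (fun y => (F y).1) c.1 (by fun_prop) (fun y => (F y).2) (fun y hy => by rw [hFB y hy])
  let e : (Fin k → unitInterval) → (Fin k → ℝ) := fun y i => y i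
  have hcle : ∀ y, cl (e y) = y := fun y => funext fun i => projIcc_val _ _
  have heB : ∀ y ∈ Cube.boundary (Fin k), e y ∈ outer k := by
    rintro y ⟨i, hi | hi⟩
    · exact ⟨i, Or.inl (by simp [e, hi])⟩
    · exact ⟨i, Or.inr (by simp [e, hi])⟩
  refine ⟨{ toFun := fun p => Quot.mk _ (⟨H (p.1, e p.2), h2 _⟩ : Conf n)
            continuous_toFun := ?_
            map_zero_left := ?_
            map_one_left := ?_
            prop' := ?_ }⟩
  · refine continuous_quot_mk.comp (Continuous.subtype_mk (h1.comp ?_) _)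
    exact continuous_fst.prodMk (by fun_prop)
  · intro y
    have : (⟨H (0, e y), h2 _⟩ : Conf n) = F (e y) := Subtype.ext (h3 _)
    simp only [this]
    rw [hF', hcle]
    rfl
  · intro y
    have : (⟨H (1, e y), h2 _⟩ : Conf n) = c := Subtype.ext (h4 _)
    simp only [this]
    rfl
  · intro t y hy
    have : (⟨H (t, e y), h2 _⟩ : Conf n) = c := Subtype.ext (h5 _ _ (heB y hy))
    simp only [this, ContinuousMap.coe_mk]
    exact (f.2 y hy).symm

end

/-- The unordered configuration space `Conf_n(ℂ)/Σ_n` is path-connected and aspherical: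
`π_k` is trivial for all `k ≥ 2`.  (This is the homotopy-theoretic content of the
fact that it is a classifying space for the braid group `B_n`.) -/
theorem UConf_pathConnected_and_aspherical (n : ℕ) (hn : 1 ≤ n) :
    PathConnectedSpace (UConf n) ∧
    (∀ k : ℕ, 2 ≤ k → ∀ x : UConf n, Subsingleton (HomotopyGroup (Fin k) (UConf n) x)) := by

  refine ⟨?_, fun k hk x => ⟨fun a b => ?_⟩⟩
  · have := conf_pathConnected n
    exact Quot.mk_surjective.pathConnectedSpace continuous_quot_mk
  · induction a using Quotient.inductionOn with | _ a => ?_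
    induction b using Quotient.inductionOn with | _ b => ?_
    exact Quotient.sound ((UConf_null n k hk x a).trans (UConf_null n k hk x b).symm)
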